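/- arXiv:2403.18088 — 6 statements merged into one kernel-verified Lean document; each statement's English description precedes it below -/
import Mathlib

section
/- Let K ≥ 1 be an integer coarsening factor, let Δ¹, Δ² : ℤ → ℝ be strictly positive fine-grid cell widths, and let u¹, u² : ℤ² → ℝ be fine-grid velocity fields. Define the fine-grid divergence (Du)(i,j) = (u¹(i,j) − u¹(i−1,j))/Δ¹(i) + (u²(i,j) − u²(i,j−1))/Δ²(j), the coarse widths Δ̄¹(a) = Σ_{m=0}^{K−1} Δ¹(K·a+m) and Δ̄²(b) = Σ_{m=0}^{K−1} Δ²(K·b+m), and the face-averaged coarse velocities ū¹(a,b) = Σ_{m=0}^{K−1} (Δ²(K·b+m)/Δ̄²(b))·u¹(K·a+K−1, K·b+m) and ū²(a,b) = Σ_{m=0}^{K−1} (Δ¹(K·a+m)/Δ̄¹(a))·u²(K·a+m, K·b+K−1). Then for every (a,b) ∈ ℤ², the coarse-grid divergence satisfies (ū¹(a,b) − ū¹(a−1,b))/Δ̄¹(a) + (ū²(a,b) − ū²(a,b−1))/Δ̄²(b) = Σ_{m=0}^{K−1} Σ_{l=0}^{K−1} (Δ¹(K·a+m)·Δ²(K·b+l))/(Δ̄¹(a)·Δ̄²(b))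 · (Du)(K·a+m, K·b+l); that is, the coarse divergence of the face-averaged field equals the volume-weighted average of the fine divergences over the corresponding coarse cell. -/
open Finset

/-- A sum of backward differences over a block of consecutive integers telescopes. -/
lemma sum_range_backward_difference {M : Type*} [AddCommGroup M] (f : ℤ → M) (c : ℤ) (K : ℕ) :
    ∑ m ∈ range K, (f (c + m) - f (c + m - 1)) = f (c + K - 1) - f (c - 1) := by
  have h := sum_range_sub (fun m : ℕ => f (c + m - 1)) K
  simpa [← add_assoc] using h

/-- On a 2D staggered grid with coarsening factor `K ≥ 1`, the coarse divergence of the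
face-averaged field equals the volume-weighted average of the fine divergences over the
corresponding coarse cell. -/
theorem face_average_coarse_divergence_eq_weighted_fine_divergence
    (K : ℕ) (hK : 1 ≤ K)
    (Δ1 Δ2 : ℤ → ℝ)
    (hΔ1 : ∀ i, 0 < Δ1 i) (hΔ2 : ∀ j, 0 < Δ2 j)
    (u1 u2 : ℤ → ℤ → ℝ)
    (Du : ℤ → ℤ → ℝ)
    (hDu : ∀ i j, Du i j =
      (u1 i j - u1 (i - 1) j) / Δ1 i + (u2 i j - u2 i (j - 1)) / Δ2 j)
    (Δb1 Δb2 : ℤ → ℝ)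
    (hΔb1 : ∀ a, Δb1 a = ∑ m ∈ range K, Δ1 ((K : ℤ) * a + (m : ℤ)))
    (hΔb2 : ∀ b, Δb2 b = ∑ m ∈ range K, Δ2 ((K : ℤ) * b + (m : ℤ)))
    (ub1 ub2 : ℤ → ℤ → ℝ)
    (hub1 : ∀ a b, ub1 a b =
      ∑ m ∈ range K, (Δ2 ((K : ℤ) * b + (m : ℤ)) / Δb2 b) *
        u1 ((K : ℤ) * a + (K : ℤ) - 1) ((K : ℤ) * b + (m : ℤ)))
    (hub2 : ∀ a b, ub2 a b =
      ∑ m ∈ range K, (Δ1 ((K : ℤ) * a + (m : ℤ)) / Δb1 a) *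
        u2 ((K : ℤ) * a + (m : ℤ)) ((K : ℤ) * b + (K : ℤ) - 1))
    (a b : ℤ) :
    (ub1 a b - ub1 (a - 1) b) / Δb1 a + (ub2 a b - ub2 a (b - 1)) / Δb2 b =
      ∑ m ∈ range K, ∑ l ∈ range K,
        (Δ1 ((K : ℤ) * a + (m : ℤ)) * Δ2 ((K : ℤ) * b + (l : ℤ))) / (Δb1 a * Δb2 b) *
          Du ((K : ℤ) * a + (m : ℤ)) ((K : ℤ) * b + (l : ℤ)) := by
  have flux1 : (ub1 a b - ub1 (a - 1) b) / Δb1 a = ∑ m ∈ range K, ∑ l ∈ range K,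
      Δ2 (K * b + l) / (Δb1 a * Δb2 b) *
        (u1 (K * a + m) (K * b + l) - u1 (K * a + m - 1) (K * b + l)) := by
    rw [sum_comm, hub1, hub1, ← sum_sub_distrib, sum_div]
    refine sum_congr rfl fun l _ => ?_
    rw [← mul_sum, sum_range_backward_difference (fun i => u1 i (K * b + l)),
      show (K : ℤ) * (a - 1) + K - 1 = K * a - 1 by ring]
    ring
  have flux2 : (ub2 a b - ub2 a (b - 1)) / Δb2 b = ∑ m ∈ range K, ∑ l ∈ range K,
      Δ1 (K * a + m) / (Δb1 a * Δb2 b) *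
        (u2 (K * a + m) (K * b + l) - u2 (K * a + m) (K * b + l - 1)) := by
    rw [hub2, hub2, ← sum_sub_distrib, sum_div]
    refine sum_congr rfl fun m _ => ?_
    rw [← mul_sum, sum_range_backward_difference (fun j => u2 (K * a + m) j),
      show (K : ℤ) * (b - 1) + K - 1 = K * b - 1 by ring]
    ring
  rw [flux1, flux2, ← sum_add_distrib]
  refine sum_congr rfl fun m _ => ?_
  rw [← sum_add_distrib]
  refine sum_congr rfl fun l _ => ?_
  have h1 := (hΔ1 (K * a + m)).ne'
  have h2 := (hΔ2 (K * b + l)).ne'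
  rw [hDu]
  field_simp
end

section
/- Let d ≥ 1 and K ≥ 1 be integers, and for each α ∈ Fin d let u_α : (Fin d → ℤ) → ℝ be a fine-grid velocity component on a uniform staggered grid. Define the (unscaled) fine-grid divergence (Du)(I) = Σ_{α} (u_α(I) − u_α(I − e_α)), where e_α is the α-th standard basis vector of ℤ^d, and define the face-averaged coarse velocities ū_α(J) = K^{−(d−1)} · Σ_{j} u_α(K·J + j), where the sum ranges over all offsets j ∈ ℤ^d with j_α = K−1 and 0 ≤ j_β ≤ K−1 for all β ≠ α. Then for every coarse index J ∈ ℤ^d, Σ_{α} (ū_α(J) − ū_α(J − e_α)) = K^{1−d} · Σ_{j ∈ {0,…,K−1}^d} (Du)(K·J + j); that is, the coarse divergence of the face-averaged field is K^{1−d} times the sum of the fine divergences over the K^d fine cells composing the coarse cell. -/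
open Finset

/-- Sums over functions on `Fin (n + 1)` split off the coordinate `α`. -/
theorem sum_pi_fin_eq_sum_insertNth {n : ℕ} {κ M : Type*} [Fintype κ] [AddCommMonoid M]
    (α : Fin (n + 1)) (f : (Fin (n + 1) → κ) → M) :
    ∑ j, f j = ∑ r : Fin n → κ, ∑ i : κ, f (α.insertNth i r) := by
  rw [← (Fin.insertNthEquiv (fun _ => κ) α).sum_comp f, Fintype.sum_prod_type_right]
  rfl

/-- Casting to `ℤ` and shifting in direction `α` acts on the coordinate `α` alone. -/
theorem cast_insertNth_sub_single {n K : ℕ} (α : Fin (n + 1)) (i : Fin K) (r : Fin n → Fin K)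
    (c : ℤ) :
    (fun β => (((α.insertNth i r : Fin (n + 1) → Fin K) β : ℕ) : ℤ) - if β = α then c else 0) =
      (α.insertNth (((i : ℕ) : ℤ) - c) (fun γ => ((r γ : ℕ) : ℤ)) : Fin (n + 1) → ℤ) := by
  funext β
  induction β using α.succAboveCases with
  | x => simp
  | p γ => simp [Fin.succAbove_ne]

/-- Summing the backward differences of `F` in direction `α` over the cube `{0, …, K - 1}^d`
telescopes to the difference of its sums over two opposite faces. -/
theorem sum_face_sub_sum_opposite_face {d K : ℕ} (hK : 1 ≤ K) (α : Fin d)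
    (F : (Fin d → ℤ) → ℝ) :
    ∑ j ∈ Finset.univ.filter (fun j : Fin d → Fin K => (j α : ℕ) = K - 1),
        F (fun β => ((j β : ℕ) : ℤ)) -
      ∑ j ∈ Finset.univ.filter (fun j : Fin d → Fin K => (j α : ℕ) = K - 1),
        F (fun β => ((j β : ℕ) : ℤ) - if β = α then (K : ℤ) else 0) =
      ∑ j : Fin d → Fin K, (F (fun β => ((j β : ℕ) : ℤ)) -
        F (fun β => ((j β : ℕ) : ℤ) - if β = α then 1 else 0)) := by
  obtain ⟨m, rfl⟩ : ∃ m, K = m + 1 := ⟨K - 1, by omega⟩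
  cases d with
  | zero => exact α.elim0
  | succ n =>
    have cast_insertNth (i : Fin (m + 1)) (r : Fin n → Fin (m + 1)) :
        (fun β => (((α.insertNth i r : Fin (n + 1) → Fin (m + 1)) β : ℕ) : ℤ)) =
          (α.insertNth ((i : ℕ) : ℤ) (fun γ => ((r γ : ℕ) : ℤ)) : Fin (n + 1) → ℤ) := by
      simpa using cast_insertNth_sub_single α i r 0
    have eq_last (i : Fin (m + 1)) : (i : ℕ) = m + 1 - 1 ↔ i = Fin.last m := by
      simp [Fin.ext_iff]
    rw [← Finset.sum_sub_distrib, Finset.sum_filter, sum_pi_fin_eq_sum_insertNth α,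
      sum_pi_fin_eq_sum_insertNth α]
    refine Finset.sum_congr rfl fun r _ => ?_
    simp only [cast_insertNth_sub_single, cast_insertNth, Fin.insertNth_apply_same, eq_last,
      Finset.sum_ite_eq', Finset.mem_univ, if_true, Fin.val_last]
    set G : ℤ → ℝ := fun x => F (α.insertNth x fun γ => ((r γ : ℕ) : ℤ)) with hG
    change G (m : ℤ) - G ((m : ℤ) - ((m + 1 : ℕ) : ℤ)) =
      ∑ i : Fin (m + 1), (G ((i : ℕ) : ℤ) - G (((i : ℕ) : ℤ) - 1))
    rw [Fin.sum_univ_eq_sum_range (fun i : ℕ => G (i : ℤ) - G ((i : ℤ) - 1))]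
    have telescope := Finset.sum_range_sub (fun i : ℕ => G ((i : ℤ) - 1)) (m + 1)
    simpa using telescope.symm

/-- On a uniform `d`-dimensional staggered grid with coarsening factor `K ≥ 1`, the coarse
divergence of the face-averaged field is `K^(1-d)` times the sum of the fine divergences over
the `K^d` fine cells composing the coarse cell. -/
theorem face_average_coarse_divergence_eq_scaled_fine_divergence_sum
    (d K : ℕ) (hd : 1 ≤ d) (hK : 1 ≤ K)
    (u : Fin d → (Fin d → ℤ) → ℝ)
    (Du : (Fin d → ℤ) → ℝ)
    (hDu : ∀ I, Du I =
      ∑ α : Fin d, (u α I - u α (fun β => I β - if β = α then 1 else 0)))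
    (ub : Fin d → (Fin d → ℤ) → ℝ)
    (hub : ∀ (α : Fin d) (J : Fin d → ℤ), ub α J =
      ((K : ℝ) ^ (d - 1))⁻¹ *
        ∑ j ∈ Finset.univ.filter (fun j : Fin d → Fin K => (j α : ℕ) = K - 1),
          u α (fun β => (K : ℤ) * J β + ((j β : ℕ) : ℤ)))
    (J : Fin d → ℤ) :
    ∑ α : Fin d, (ub α J - ub α (fun β => J β - if β = α then 1 else 0)) =
      (K : ℝ) ^ ((1 : ℤ) - (d : ℤ)) *
        ∑ j : Fin d → Fin K, Du (fun β => (K : ℤ) * J β + ((j β : ℕ) : ℤ)) := by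
  have scale : (K : ℝ) ^ ((1 : ℤ) - (d : ℤ)) = ((K : ℝ) ^ (d - 1))⁻¹ := by
    rw [← zpow_natCast, ← zpow_neg, Nat.cast_sub hd]
    simp
  simp only [hub, hDu, scale]
  rw [Finset.sum_comm, Finset.mul_sum]
  refine Finset.sum_congr rfl fun α _ => ?_
  rw [← mul_sub]
  congr 1
  have telescope := sum_face_sub_sum_opposite_face hK α
    fun I => u α fun β => (K : ℤ) * J β + I β
  simp only [← add_sub_assoc] at telescope
  rw [← telescope]
  congr 1
  refine Finset.sum_congr rfl fun j _ => congrArg (u α) (funext fun β => ?_)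
  split_ifs <;> ring
end

section
/- Let d ≥ 1 and K ≥ 1 be integers, and for each α ∈ Fin d let u_α : (Fin d → ℤ) → ℝ be a fine-grid velocity component on a uniform staggered grid. Define the (unscaled) fine-grid divergence (Du)(I) = Σ_{α} (u_α(I) − u_α(I − e_α)), where e_α is the α-th standard basis vector of ℤ^d, and define the face-averaged coarse velocities ū_α(J) = K^{−(d−1)} · Σ_{j} u_α(K·J + j), where the sum ranges over all offsets j ∈ ℤ^d with j_α = K−1 and 0 ≤ j_β ≤ K−1 for all β ≠ α. If (Du)(I) = 0 for all I ∈ ℤ^d, then Σ_{α} (ū_α(J) − ū_α(J − e_α)) = 0 for all J ∈ ℤ^d; that is, on a uniform d-dimensional staggered grid the face-averaging filter maps discretely divergence-free velocity fields to discretely divergence-free coarse velocity fields. -/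
open Finset

/-- Telescoping over a coarse cell: summing the backward differences of `f` in direction `α` over
all fine cells of a coarse cell leaves the difference between its two faces normal to `α`. -/
theorem sum_face_sub_face_eq_sum_backward_diff {d K : ℕ} {G : Type*} [AddCommGroup G]
    (α : Fin d) (f : (Fin d → ℤ) → G) (J : Fin d → ℤ) :
    ∑ j ∈ Finset.univ.filter (fun j : Fin d → Fin K => (j α : ℕ) = K - 1),
        (f (fun β => (K : ℤ) * J β + ((j β : ℕ) : ℤ)) -
          f (fun β => (K : ℤ) * (J β - if β = α then 1 else 0) + ((j β : ℕ) : ℤ))) =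
      ∑ j : Fin d → Fin K,
        (f (fun β => (K : ℤ) * J β + ((j β : ℕ) : ℤ)) -
          f (fun β => (K : ℤ) * J β + ((j β : ℕ) : ℤ) - if β = α then 1 else 0)) := by
  obtain _ | n := K
  · have : IsEmpty (Fin d → Fin 0) := ⟨fun j => (j α).elim0⟩
    simp
  let σ : (Fin d → Fin (n + 1)) ≃ (Fin d → Fin (n + 1)) :=
    Equiv.piCongrRight fun β => if β = α then finRotate (n + 1) else Equiv.refl _
  have hσ (j : Fin d → Fin (n + 1)) (β : Fin d) :
      σ j β = if β = α then finRotate (n + 1) (j β) else j β := by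
    simp only [σ, Equiv.piCongrRight_apply, Pi.map_apply]
    split_ifs <;> rfl
  rw [Finset.sum_sub_distrib (s := Finset.univ), ← Equiv.sum_comp σ (fun j =>
    f (fun β => ((n + 1 : ℕ) : ℤ) * J β + ((j β : ℕ) : ℤ) - if β = α then 1 else 0)),
    ← Finset.sum_sub_distrib, Finset.sum_filter]
  refine Finset.sum_congr rfl fun j _ => ?_
  split_ifs with h
  · congr 2
    funext β
    rw [hσ]
    split_ifs with hβ
    · subst hβ
      have hj : j β = Fin.last n := Fin.ext (by simpa using h)
      rw [hj, finRotate_last]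
      push_cast [Fin.val_last, Fin.val_zero]
      ring
    · ring
  · symm
    rw [sub_eq_zero]
    congr 1
    funext β
    rw [hσ]
    split_ifs with hβ
    · subst hβ
      have hj : j β ≠ Fin.last n := fun e => h (by simp [e])
      rw [coe_finRotate_of_ne_last hj]
      push_cast
      ring
    · ring

/-- On a uniform `d`-dimensional staggered grid, the face-averaging filter maps discretely
divergence-free velocity fields to discretely divergence-free coarse velocity fields. -/
theorem face_average_divergence_consistent_uniform
    (d K : ℕ) (hd : 1 ≤ d) (hK : 1 ≤ K)
    (u : Fin d → (Fin d → ℤ) → ℝ)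
    (Du : (Fin d → ℤ) → ℝ)
    (hDu : ∀ I, Du I =
      ∑ α : Fin d, (u α I - u α (fun β => I β - if β = α then 1 else 0)))
    (ub : Fin d → (Fin d → ℤ) → ℝ)
    (hub : ∀ (α : Fin d) (J : Fin d → ℤ), ub α J =
      ((K : ℝ) ^ (d - 1))⁻¹ *
        ∑ j ∈ Finset.univ.filter (fun j : Fin d → Fin K => (j α : ℕ) = K - 1),
          u α (fun β => (K : ℤ) * J β + ((j β : ℕ) : ℤ)))
    (hdivfree : ∀ I : Fin d → ℤ, Du I = 0)
    (J : Fin d → ℤ) :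
    ∑ α : Fin d, (ub α J - ub α (fun β => J β - if β = α then 1 else 0)) = 0 := by
  have hface (α : Fin d) : ub α J - ub α (fun β => J β - if β = α then 1 else 0) =
      ((K : ℝ) ^ (d - 1))⁻¹ * ∑ j : Fin d → Fin K,
        (u α (fun β => (K : ℤ) * J β + ((j β : ℕ) : ℤ)) -
          u α (fun β => (K : ℤ) * J β + ((j β : ℕ) : ℤ) - if β = α then 1 else 0)) := by
    rw [hub, hub, ← mul_sub, ← Finset.sum_sub_distrib, sum_face_sub_face_eq_sum_backward_diff]
  simp_rw [hface]
  rw [← Finset.mul_sum, Finset.sum_comm]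
  simp_rw [← hDu, hdivfree]
  simp
end

section
/- Let N and M be positive integers, let D be a real N×M matrix, let Ω_p be an N×N diagonal matrix with strictly positive diagonal entries, let Ω_u be an M×M diagonal matrix with strictly positive diagonal entries, and let e ∈ ℝ^N be the all-ones vector. Set G = −Ω_u⁻¹·Dᵀ·Ω_p and L = Ω_p·D·G, and assume {v ∈ ℝ^N : Dᵀ·Ω_p·v = 0} = span{e}. Then the bordered matrix B = [[L, e],[eᵀ, 0]] is invertible; defining L† as the top-left N×N block of B⁻¹ and the projection matrix P = I − G·L†·Ω_p·D, one has D·P = 0, i.e. for every velocity vector w ∈ ℝ^M the projected vector P·w is discretely divergence-free. -/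
open Matrix

/-- A Gram matrix with positive weights has the same kernel as the underlying matrix. -/
theorem mulVec_eq_zero_of_weighted_gram {m n : Type*} [Fintype m] [Fintype n] [DecidableEq m]
    (A : Matrix m n ℝ) {w : m → ℝ} (hw : ∀ i, 0 < w i) {v : n → ℝ}
    (h : (Aᵀ * diagonal w * A) *ᵥ v = 0) : A *ᵥ v = 0 := by
  have hsum : ∑ i, (A *ᵥ v) i * (w i * (A *ᵥ v) i) = 0 := by
    have h' : v ⬝ᵥ ((Aᵀ * diagonal w * A) *ᵥ v) = 0 := by rw [h, dotProduct_zero]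
    rw [← mulVec_mulVec, ← mulVec_mulVec, dotProduct_mulVec, vecMul_transpose] at h'
    simpa only [dotProduct, mulVec_diagonal] using h'
  have hnonneg : ∀ i ∈ Finset.univ, 0 ≤ (A *ᵥ v) i * (w i * (A *ᵥ v) i) := fun i _ => by
    nlinarith [mul_nonneg (hw i).le (mul_self_nonneg ((A *ᵥ v) i))]
  funext i
  have hi := (Finset.sum_eq_zero_iff_of_nonneg hnonneg).1 hsum i (Finset.mem_univ i)
  simpa [(hw i).ne'] using hi

/-- Bordering a symmetric matrix by a nonzero vector spanning its kernel makes it invertible. -/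
theorem isUnit_fromBlocks_border {n : Type*} [Fintype n] [DecidableEq n]
    {L : Matrix n n ℝ} {e : n → ℝ} (he : e ≠ 0) (heL : e ᵥ* L = 0)
    (hker : ∀ v, L *ᵥ v = 0 → ∃ c : ℝ, v = c • e) :
    IsUnit (fromBlocks L (replicateCol Unit e) (replicateRow Unit e) 0) := by
  have hee : e ⬝ᵥ e ≠ 0 := fun h => he (dotProduct_self_eq_zero.1 h)
  rw [← mulVec_injective_iff_isUnit, ← coe_mulVecLin, ← LinearMap.ker_eq_bot, LinearMap.ker_eq_bot']
  intro x hx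
  obtain ⟨v, s, rfl⟩ : ∃ (v : n → ℝ) (s : Unit → ℝ), x = Sum.elim v s :=
    ⟨x ∘ Sum.inl, x ∘ Sum.inr, (Sum.elim_comp_inl_inr x).symm⟩
  rw [mulVecLin_apply, fromBlocks_mulVec] at hx
  have htop : L *ᵥ v + s () • e = 0 := by
    funext i
    simpa [mulVec, dotProduct, mul_comm] using congrFun hx (Sum.inl i)
  have hbot : e ⬝ᵥ v = 0 := by
    simpa [mulVec, dotProduct] using congrFun hx (Sum.inr ())
  have hs : s () = 0 := by
    have h := congrArg (e ⬝ᵥ ·) htop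
    simpa [dotProduct_add, dotProduct_mulVec, heL, hee, he] using h
  obtain ⟨c, rfl⟩ := hker v (by simpa [hs] using htop)
  have hc : c = 0 := by simpa [hee, he] using hbot
  funext i
  rcases i with i | i
  · simp [hc]
  · simpa using hs

/-- The top-left block `X` of the inverse of a bordered matrix satisfies `L * X * C = C` for
every `C` annihilated on the left by the bordering vector. -/
theorem mul_toBlocks₁₁_inv_border_mul {n k : Type*} [Fintype n] [DecidableEq n]
    {L : Matrix n n ℝ} {e : n → ℝ} (he : e ≠ 0) (heL : e ᵥ* L = 0)
    (hB : IsUnit (fromBlocks L (replicateCol Unit e) (replicateRow Unit e) 0))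
    {C : Matrix n k ℝ} (hC : e ᵥ* C = 0) :
    L * (fromBlocks L (replicateCol Unit e) (replicateRow Unit e) 0)⁻¹.toBlocks₁₁ * C = C := by
  have hee : e ⬝ᵥ e ≠ 0 := fun h => he (dotProduct_self_eq_zero.1 h)
  have hinv := mul_nonsing_inv _ ((isUnit_iff_isUnit_det _).1 hB)
  generalize (fromBlocks L (replicateCol Unit e) (replicateRow Unit e) 0)⁻¹ = X at hinv ⊢
  have hblock : L * X.toBlocks₁₁ + replicateCol Unit e * X.toBlocks₂₁ = 1 := by
    rw [← fromBlocks_toBlocks X, fromBlocks_multiply, ← fromBlocks_one, fromBlocks_inj] at hinv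
    simpa using hinv.1
  set y : n → ℝ := X.toBlocks₂₁ ()
  have hcol : replicateCol Unit e * X.toBlocks₂₁ = vecMulVec e y := by
    ext i j
    simp [mul_apply, vecMulVec_apply, y]
  rw [hcol] at hblock
  have hy : (e ⬝ᵥ e) • y = e := by
    have h := congrArg (e ᵥ* ·) hblock
    simpa [vecMul_add, ← vecMul_vecMul, heL, vecMul_vecMulVec] using h
  have hyC : y ᵥ* C = 0 := by
    have h : (e ⬝ᵥ e) • (y ᵥ* C) = 0 := by rw [← smul_vecMul, hy, hC]
    exact (smul_eq_zero.1 h).resolve_left hee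
  have h := congrArg (· * C) hblock
  have hzero : vecMulVec e (0 : k → ℝ) = 0 := by ext; simp [vecMulVec_apply]
  simpa [Matrix.add_mul, vecMulVec_mul, hyC, hzero] using h

/-- The bordered matrix `B = [[L, e],[eᵀ, 0]]` is invertible, and the projection
`P = I − G·L†·Ωp·D` maps every velocity vector to a discretely divergence-free one:
`D·P = 0`. -/
theorem projection_makes_divergence_free
    (N M : ℕ) (hN : 0 < N) (hM : 0 < M)
    (D : Matrix (Fin N) (Fin M) ℝ)
    (dp : Fin N → ℝ) (hdp : ∀ i, 0 < dp i)
    (du : Fin M → ℝ) (hdu : ∀ i, 0 < du i)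
    (Ωp : Matrix (Fin N) (Fin N) ℝ) (hΩp : Ωp = Matrix.diagonal dp)
    (Ωu : Matrix (Fin M) (Fin M) ℝ) (hΩu : Ωu = Matrix.diagonal du)
    (e : Fin N → ℝ) (he : e = fun _ => 1)
    (G : Matrix (Fin M) (Fin N) ℝ) (hG : G = -(Ωu⁻¹ * Dᵀ * Ωp))
    (L : Matrix (Fin N) (Fin N) ℝ) (hL : L = Ωp * D * G)
    (hker : ∀ v : Fin N → ℝ, (Dᵀ * Ωp) *ᵥ v = 0 ↔ ∃ c : ℝ, v = c • e)
    (B : Matrix (Fin N ⊕ Unit) (Fin N ⊕ Unit) ℝ)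
    (hB : B = Matrix.fromBlocks L (Matrix.of fun i (_ : Unit) => e i)
      (Matrix.of fun (_ : Unit) j => e j) 0)
    (Ldag : Matrix (Fin N) (Fin N) ℝ)
    (hLdag : Ldag = Matrix.toBlocks₁₁ B⁻¹)
    (P : Matrix (Fin M) (Fin M) ℝ)
    (hP : P = 1 - G * Ldag * Ωp * D) :
    IsUnit B ∧ D * P = 0 := by
  subst hP hLdag hB hL hG hΩp hΩu
  have hne : e ≠ 0 := fun h => by
    simpa [he] using congrFun h ⟨0, hN⟩
  have heD : e ᵥ* (diagonal dp * D) = 0 := by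
    have h := (hker e).2 ⟨1, (one_smul ℝ e).symm⟩
    rwa [← vecMul_transpose, transpose_mul, transpose_transpose, diagonal_transpose] at h
  have hinv : (diagonal du)⁻¹ = diagonal fun i => (du i)⁻¹ :=
    inv_eq_left_inv (by simp [diagonal_mul_diagonal, (hdu _).ne'])
  set G := -((diagonal du)⁻¹ * Dᵀ * diagonal dp) with hG
  have heL : e ᵥ* (diagonal dp * D * G) = 0 := by
    rw [← vecMul_vecMul, heD, zero_vecMul]
  have hLker : ∀ v, (diagonal dp * D * G) *ᵥ v = 0 → ∃ c : ℝ, v = c • e := fun v hv => by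
    refine (hker v).1 (mulVec_eq_zero_of_weighted_gram _ (fun i => inv_pos.2 (hdu i)) ?_)
    rw [← hinv, transpose_mul, transpose_transpose, diagonal_transpose]
    simpa [hG, neg_mulVec, Matrix.mul_assoc] using hv
  have hB := isUnit_fromBlocks_border hne heL hLker
  have hcancel := mul_toBlocks₁₁_inv_border_mul hne heL hB heD
  refine ⟨hB, ?_⟩
  have hdet : IsUnit (diagonal dp).det := by
    rw [det_diagonal]
    exact (Finset.prod_pos fun i _ => hdp i).ne'.isUnit
  rw [← nonsing_inv_mul_cancel_left (A := diagonal dp) (D * _) hdet]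
  convert Matrix.mul_zero _
  rw [Matrix.mul_sub, Matrix.mul_sub, Matrix.mul_one, sub_eq_zero]
  simp only [Matrix.mul_assoc] at hcancel ⊢
  exact hcancel.symm
end

section
/- Let N and M be positive integers, let D be a real N×M matrix, let Ω_p be an N×N diagonal matrix with strictly positive diagonal entries, let Ω_u be an M×M diagonal matrix with strictly positive diagonal entries, and let e ∈ ℝ^N be the all-ones vector. Set G = −Ω_u⁻¹·Dᵀ·Ω_p and L = Ω_p·D·G, and assume {v ∈ ℝ^N : Dᵀ·Ω_p·v = 0} = span{e}. With L† the top-left N×N block of the inverse of the bordered matrix B = [[L, e],[eᵀ, 0]] and P = I − G·L†·Ω_p·D, the matrix P is idempotent: P·P = P. -/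
open Matrix

/-- The top-left block of the inverse of a bordered matrix `[[A, C], [R, 0]]` is an outer
generalized inverse of `A`. Singular bordered matrices are covered, their inverse being `0`. -/
theorem Matrix.toBlocks₁₁_inv_fromBlocks_zero₂₂_mul_mul {m n R : Type*} [Fintype m] [Fintype n]
    [DecidableEq m] [DecidableEq n] [CommRing R]
    (A : Matrix m m R) (C : Matrix m n R) (E : Matrix n m R) :
    (fromBlocks A C E 0)⁻¹.toBlocks₁₁ * A * (fromBlocks A C E 0)⁻¹.toBlocks₁₁ =
      (fromBlocks A C E 0)⁻¹.toBlocks₁₁ := by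
  by_cases h : IsUnit (fromBlocks A C E 0).det
  · have hl := nonsing_inv_mul _ h
    have hr := mul_nonsing_inv _ h
    rw [← fromBlocks_toBlocks (fromBlocks A C E 0)⁻¹, fromBlocks_multiply, ← fromBlocks_one,
      fromBlocks_inj] at hl hr
    obtain ⟨hl, -⟩ := hl
    obtain ⟨-, -, hr, -⟩ := hr
    rw [Matrix.zero_mul, add_zero] at hr
    rw [eq_sub_of_add_eq hl, Matrix.sub_mul, Matrix.mul_assoc, hr, Matrix.mul_zero,
      Matrix.one_mul, sub_zero]
  · rw [nonsing_inv_apply_not_isUnit _ h]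
    ext
    simp [toBlocks₁₁, Matrix.mul_apply]

/-- The pressure projection matrix `P = I − G·L†·Ωp·D` is idempotent: `P·P = P`. -/
theorem projection_idempotent
    (N M : ℕ) (hN : 0 < N) (hM : 0 < M)
    (D : Matrix (Fin N) (Fin M) ℝ)
    (dp : Fin N → ℝ) (hdp : ∀ i, 0 < dp i)
    (du : Fin M → ℝ) (hdu : ∀ i, 0 < du i)
    (Ωp : Matrix (Fin N) (Fin N) ℝ) (hΩp : Ωp = Matrix.diagonal dp)
    (Ωu : Matrix (Fin M) (Fin M) ℝ) (hΩu : Ωu = Matrix.diagonal du)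
    (e : Fin N → ℝ) (he : e = fun _ => 1)
    (G : Matrix (Fin M) (Fin N) ℝ) (hG : G = -(Ωu⁻¹ * Dᵀ * Ωp))
    (L : Matrix (Fin N) (Fin N) ℝ) (hL : L = Ωp * D * G)
    (hker : ∀ v : Fin N → ℝ, (Dᵀ * Ωp) *ᵥ v = 0 ↔ ∃ c : ℝ, v = c • e)
    (B : Matrix (Fin N ⊕ Unit) (Fin N ⊕ Unit) ℝ)
    (hB : B = Matrix.fromBlocks L (Matrix.of fun i (_ : Unit) => e i)
      (Matrix.of fun (_ : Unit) j => e j) 0)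
    (Ldag : Matrix (Fin N) (Fin N) ℝ)
    (hLdag : Ldag = Matrix.toBlocks₁₁ B⁻¹)
    (P : Matrix (Fin M) (Fin M) ℝ)
    (hP : P = 1 - G * Ldag * Ωp * D) :
    P * P = P := by
  have hLdag_mul : Ldag * L * Ldag = Ldag := by
    rw [hLdag, hB]
    exact toBlocks₁₁_inv_fromBlocks_zero₂₂_mul_mul _ _ _
  have hidem : IsIdempotentElem (G * Ldag * Ωp * D) := by
    calc G * Ldag * Ωp * D * (G * Ldag * Ωp * D)
        = G * (Ldag * (Ωp * D * G) * Ldag) * Ωp * D := by simp only [Matrix.mul_assoc]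
      _ = G * Ldag * Ωp * D := by rw [← hL, hLdag_mul]
  rw [hP]
  exact hidem.one_sub
end

section
/- Consider a fine-grid setup (N, M, D, Ω_p, Ω_u, e, G, L, L†, P) and a coarse-grid setup (N̄, M̄, D̄, Ω̄_p, Ω̄_u, ē, Ḡ, L̄, L̄†, P̄), each consisting of: a real divergence matrix (N×M resp. N̄×M̄), diagonal matrices with strictly positive diagonal entries, the all-ones vector, G = −Ω_u⁻¹·Dᵀ·Ω_p, L = Ω_p·D·G, the assumption {v : Dᵀ·Ω_p·v = 0} = span{e}, L† the top-left block of the inverse of the bordered matrix [[L, e],[eᵀ, 0]], and P = I − G·L†·Ω_p·D (and analogously with bars). Let Φ be a real M̄×M matrix that is divergence-consistent: for all w ∈ ℝ^M, D·w = 0 implies D̄·(Φ·w) = 0. Then for all w ∈ ℝ^M and z ∈ ℝ^M̄, the vector c = Φ·(P·w) − P̄·z satisfies D̄·c = 0 and P̄·c = c; in particular, any commutator error formed as the difference between a filtered projected fine-grid right-hand side and a projected coarse-grid right-hand side is discretely divergence-free and invariant under the coarse-grid projection. -/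
open Matrix

section PressureProjection

variable {m n : Type*} [Fintype m] [Fintype n] [DecidableEq m]

/-- A vector on which the quadratic form of the weighted Gram matrix `Aᵀ * diagonal d * A`, with
positive weights `d`, vanishes lies in the kernel of `A`. -/
lemma mulVec_eq_zero_of_weighted_gram_form_eq_zero {d : m → ℝ} (hd : ∀ i, 0 < d i)
    (A : Matrix m n ℝ) {x : n → ℝ} (hx : x ⬝ᵥ ((Aᵀ * diagonal d * A) *ᵥ x) = 0) :
    A *ᵥ x = 0 := by
  have h : ∑ i, d i * (A *ᵥ x) i ^ 2 = 0 := by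
    rw [← hx, ← mulVec_mulVec, ← mulVec_mulVec, dotProduct_mulVec, vecMul_transpose,
      dotProduct]
    refine Finset.sum_congr rfl fun i _ => ?_
    rw [mulVec_diagonal]
    ring
  rw [Finset.sum_eq_zero_iff_of_nonneg
    fun i _ => mul_nonneg (hd i).le (sq_nonneg _)] at h
  ext i
  simpa [(hd i).ne'] using h i (Finset.mem_univ i)

variable [DecidableEq n]

/-- Bordering a negated weighted Gram matrix of `A` by the all-ones vector gives an invertible
matrix when the kernel of `A` is spanned by that vector. -/
lemma isUnit_det_bordered_neg_weighted_gram [Nonempty n] {d : m → ℝ} (hd : ∀ i, 0 < d i)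
    (A : Matrix m n ℝ)
    (hker : ∀ v : n → ℝ, A *ᵥ v = 0 ↔ ∃ c : ℝ, v = c • fun _ => (1 : ℝ)) :
    IsUnit (fromBlocks (-(Aᵀ * diagonal d * A)) (of fun (_ : n) (_ : Unit) => (1 : ℝ))
      (of fun (_ : Unit) (_ : n) => (1 : ℝ)) 0).det := by
  have hcard : (Fintype.card n : ℝ) ≠ 0 := Nat.cast_ne_zero.2 Fintype.card_ne_zero
  have hones : A *ᵥ (fun _ => (1 : ℝ)) = 0 := (hker _).2 ⟨1, (one_smul ℝ _).symm⟩
  rw [isUnit_iff_ne_zero]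
  intro hdet
  obtain ⟨v, hv, hv0⟩ := exists_mulVec_eq_zero_iff.2 hdet
  obtain ⟨x, y, rfl⟩ : ∃ (x : n → ℝ) (y : Unit → ℝ), v = Sum.elim x y :=
    ⟨v ∘ Sum.inl, v ∘ Sum.inr, (Sum.elim_comp_inl_inr v).symm⟩
  rw [fromBlocks_mulVec] at hv0
  have hsum : ∑ i, x i = 0 := by
    simpa [mulVec, dotProduct] using congrFun hv0 (Sum.inr ())
  have hrow (i : n) : ((Aᵀ * diagonal d * A) *ᵥ x) i = y () := by
    have := congrFun hv0 (Sum.inl i)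
    simp only [Sum.elim_comp_inl, Sum.elim_comp_inr, Sum.elim_inl, Pi.add_apply, neg_mulVec,
      Pi.neg_apply, Pi.zero_apply] at this
    have hy : ((of fun (_ : n) (_ : Unit) => (1 : ℝ)) *ᵥ y) i = y () := by
      simp [mulVec, dotProduct]
    linarith
  have hform : x ⬝ᵥ ((Aᵀ * diagonal d * A) *ᵥ x) = 0 := by
    simp only [dotProduct, hrow, ← Finset.sum_mul, hsum, zero_mul]
  have hAx := mulVec_eq_zero_of_weighted_gram_form_eq_zero hd A hform
  obtain ⟨c, rfl⟩ := (hker x).1 hAx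
  have hc : c = 0 := by simpa [hcard] using hsum
  have hy : y () = 0 := by
    rw [← hrow (Classical.arbitrary n), ← mulVec_mulVec, hAx, mulVec_zero, Pi.zero_apply]
  apply hv
  ext (i | i)
  · simp [hc]
  · simpa using hy

/-- The pressure projection built from the bordered Poisson solver is discretely
divergence-free. -/
lemma divergence_mul_pressure_projection [Nonempty n] {dp : n → ℝ} (hdp : ∀ i, 0 < dp i)
    {du : m → ℝ} (hdu : ∀ i, 0 < du i) {D : Matrix n m ℝ} {G : Matrix m n ℝ}
    (hG : G = -((diagonal du)⁻¹ * Dᵀ * diagonal dp)) {L : Matrix n n ℝ}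
    (hL : L = diagonal dp * D * G)
    (hker : ∀ v : n → ℝ, (Dᵀ * diagonal dp) *ᵥ v = 0 ↔ ∃ c : ℝ, v = c • fun _ => (1 : ℝ))
    {B : Matrix (n ⊕ Unit) (n ⊕ Unit) ℝ}
    (hB : B = fromBlocks L (of fun (_ : n) (_ : Unit) => (1 : ℝ))
      (of fun (_ : Unit) (_ : n) => (1 : ℝ)) 0) :
    D * (1 - G * toBlocks₁₁ B⁻¹ * diagonal dp * D) = 0 := by
  have hcard : (Fintype.card n : ℝ) ≠ 0 := Nat.cast_ne_zero.2 Fintype.card_ne_zero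
  have hones : (Dᵀ * diagonal dp) *ᵥ (fun _ => (1 : ℝ)) = 0 :=
    (hker _).2 ⟨1, (one_smul ℝ _).symm⟩
  have hinv : (diagonal du)⁻¹ = diagonal fun i => (du i)⁻¹ := by
    apply inv_eq_right_inv
    rw [diagonal_mul_diagonal, ← diagonal_one]
    exact congrArg diagonal (funext fun i => mul_inv_cancel₀ (hdu i).ne')
  have hLA : L = -((Dᵀ * diagonal dp)ᵀ * diagonal (fun i => (du i)⁻¹) *
      (Dᵀ * diagonal dp)) := by
    rw [hL, hG, hinv]
    simp [Matrix.mul_assoc]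
  have hunit : IsUnit B.det := by
    rw [hB, hLA]
    exact isUnit_det_bordered_neg_weighted_gram (fun i => inv_pos.2 (hdu i)) _ hker
  have hBB := mul_nonsing_inv B hunit
  rw [← fromBlocks_toBlocks B⁻¹] at hBB
  nth_rewrite 1 [hB] at hBB
  rw [fromBlocks_multiply, ← fromBlocks_one, fromBlocks_inj] at hBB
  have h11 := hBB.1
  set K := toBlocks₁₁ B⁻¹
  set R := toBlocks₂₁ B⁻¹
  set E : Matrix n Unit ℝ := of fun _ _ => 1 with hE
  have hED : Eᵀ * (diagonal dp * D) = 0 := by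
    rw [← transpose_inj, transpose_mul, transpose_transpose, transpose_mul, diagonal_transpose,
      transpose_zero]
    ext i j
    exact congrFun hones i
  have hEL : Eᵀ * L = 0 := by rw [hL, ← Matrix.mul_assoc, hED, Matrix.zero_mul]
  have hEE : Eᵀ * E = (Fintype.card n : ℝ) • (1 : Matrix Unit Unit ℝ) := by
    ext i j
    simp [hE, Matrix.mul_apply]
  have hR : R * (diagonal dp * D) = 0 := by
    have h := congrArg (fun X => Eᵀ * X * (diagonal dp * D)) h11
    simp only [Matrix.mul_add, Matrix.add_mul, Matrix.mul_one, hED] at h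
    rw [← Matrix.mul_assoc Eᵀ L, hEL, ← Matrix.mul_assoc Eᵀ E, hEE] at h
    simpa [hcard] using h
  have hK : L * K * (diagonal dp * D) = diagonal dp * D := by
    have h := congrArg (· * (diagonal dp * D)) h11
    simpa only [Matrix.add_mul, Matrix.mul_assoc E, hR, Matrix.mul_zero, add_zero,
      Matrix.one_mul] using h
  have hzero : diagonal dp * (D * (1 - G * K * diagonal dp * D)) = 0 := by
    rw [← Matrix.mul_assoc, Matrix.mul_sub, Matrix.mul_one, sub_eq_zero]
    rw [hL] at hK
    simpa only [Matrix.mul_assoc] using hK.symm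
  ext i j
  simpa [diagonal_mul, (hdp i).ne'] using congrFun (congrFun hzero i) j

end PressureProjection

/-- For a fine-grid and a coarse-grid pressure-projection setup connected by a
divergence-consistent filter `Φ`, any commutator error `c = Φ·(P·w) − P̄·z` formed as the
difference between a filtered projected fine-grid right-hand side and a projected coarse-grid
right-hand side is discretely divergence-free (`D̄·c = 0`) and invariant under the coarse-grid
projection (`P̄·c = c`). -/
theorem commutator_error_divergence_free_and_projected
    -- fine grid setup
    (N M : ℕ) (hN : 0 < N) (hM : 0 < M)
    (D : Matrix (Fin N) (Fin M) ℝ)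
    (dp : Fin N → ℝ) (hdp : ∀ i, 0 < dp i)
    (du : Fin M → ℝ) (hdu : ∀ i, 0 < du i)
    (Ωp : Matrix (Fin N) (Fin N) ℝ) (hΩp : Ωp = Matrix.diagonal dp)
    (Ωu : Matrix (Fin M) (Fin M) ℝ) (hΩu : Ωu = Matrix.diagonal du)
    (e : Fin N → ℝ) (he : e = fun _ => 1)
    (G : Matrix (Fin M) (Fin N) ℝ) (hG : G = -(Ωu⁻¹ * Dᵀ * Ωp))
    (L : Matrix (Fin N) (Fin N) ℝ) (hL : L = Ωp * D * G)
    (hker : ∀ v : Fin N → ℝ, (Dᵀ * Ωp) *ᵥ v = 0 ↔ ∃ c : ℝ, v = c • e)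
    (B : Matrix (Fin N ⊕ Unit) (Fin N ⊕ Unit) ℝ)
    (hB : B = Matrix.fromBlocks L (Matrix.of fun i (_ : Unit) => e i)
      (Matrix.of fun (_ : Unit) j => e j) 0)
    (Ldag : Matrix (Fin N) (Fin N) ℝ)
    (hLdag : Ldag = Matrix.toBlocks₁₁ B⁻¹)
    (P : Matrix (Fin M) (Fin M) ℝ)
    (hP : P = 1 - G * Ldag * Ωp * D)
    -- coarse grid setup
    (Nb Mb : ℕ) (hNb : 0 < Nb) (hMb : 0 < Mb)
    (Db : Matrix (Fin Nb) (Fin Mb) ℝ)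
    (dpb : Fin Nb → ℝ) (hdpb : ∀ i, 0 < dpb i)
    (dub : Fin Mb → ℝ) (hdub : ∀ i, 0 < dub i)
    (Ωpb : Matrix (Fin Nb) (Fin Nb) ℝ) (hΩpb : Ωpb = Matrix.diagonal dpb)
    (Ωub : Matrix (Fin Mb) (Fin Mb) ℝ) (hΩub : Ωub = Matrix.diagonal dub)
    (eb : Fin Nb → ℝ) (heb : eb = fun _ => 1)
    (Gb : Matrix (Fin Mb) (Fin Nb) ℝ) (hGb : Gb = -(Ωub⁻¹ * Dbᵀ * Ωpb))
    (Lb : Matrix (Fin Nb) (Fin Nb) ℝ) (hLb : Lb = Ωpb * Db * Gb)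
    (hkerb : ∀ v : Fin Nb → ℝ, (Dbᵀ * Ωpb) *ᵥ v = 0 ↔ ∃ c : ℝ, v = c • eb)
    (Bb : Matrix (Fin Nb ⊕ Unit) (Fin Nb ⊕ Unit) ℝ)
    (hBb : Bb = Matrix.fromBlocks Lb (Matrix.of fun i (_ : Unit) => eb i)
      (Matrix.of fun (_ : Unit) j => eb j) 0)
    (Lbdag : Matrix (Fin Nb) (Fin Nb) ℝ)
    (hLbdag : Lbdag = Matrix.toBlocks₁₁ Bb⁻¹)
    (Pb : Matrix (Fin Mb) (Fin Mb) ℝ)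
    (hPb : Pb = 1 - Gb * Lbdag * Ωpb * Db)
    -- divergence-consistent filter
    (Φ : Matrix (Fin Mb) (Fin M) ℝ)
    (hΦ : ∀ w : Fin M → ℝ, D *ᵥ w = 0 → Db *ᵥ (Φ *ᵥ w) = 0) :
    ∀ (w : Fin M → ℝ) (z : Fin Mb → ℝ),
      Db *ᵥ (Φ *ᵥ (P *ᵥ w) - Pb *ᵥ z) = 0 ∧
        Pb *ᵥ (Φ *ᵥ (P *ᵥ w) - Pb *ᵥ z) = Φ *ᵥ (P *ᵥ w) - Pb *ᵥ z := by
  subst hΩp hΩu he hLdag hP hΩpb hΩub heb hLbdag hPb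
  have : Nonempty (Fin N) := ⟨⟨0, hN⟩⟩
  have : Nonempty (Fin Nb) := ⟨⟨0, hNb⟩⟩
  have hDP := divergence_mul_pressure_projection hdp hdu hG hL hker hB
  have hDPb := divergence_mul_pressure_projection hdpb hdub hGb hLb hkerb hBb
  intro w z
  have hdiv : Db *ᵥ (Φ *ᵥ ((1 - G * toBlocks₁₁ B⁻¹ * diagonal dp * D) *ᵥ w) -
      (1 - Gb * toBlocks₁₁ Bb⁻¹ * diagonal dpb * Db) *ᵥ z) = 0 := by
    rw [mulVec_sub, hΦ _ (by rw [mulVec_mulVec, hDP, zero_mulVec]), mulVec_mulVec, hDPb,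
      zero_mulVec, sub_zero]
  refine ⟨hdiv, ?_⟩
  generalize Φ *ᵥ ((1 - G * toBlocks₁₁ B⁻¹ * diagonal dp * D) *ᵥ w) -
    (1 - Gb * toBlocks₁₁ Bb⁻¹ * diagonal dpb * Db) *ᵥ z = c at hdiv ⊢
  rw [sub_mulVec, one_mulVec, ← mulVec_mulVec, hdiv, mulVec_zero, sub_zero]
end
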